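/- A Reed–Muller code of asymptotic rate R < C on any binary-input memoryless symmetric channel of capacity C has maximal bit-error probability under bitwise ML decoding satisfying P_bit = O(2^{−√(log n)/log log n}) → 0 as n → ∞. -/

import Mathlib

open Finset

/-- Probability of a single noise symbol `(e, b)` under the symmetric-channel mixture with
mixing weights `q` and crossover probabilities `eps`: the channel outputs
`Y_i = (ε_i, X_i + w_i)` with `w_i ~ Ber(eps ε_i)`. -/
noncomputable def noiseP {E : Type*} (q eps : E → ℝ) (z : E × ZMod 2) : ℝ :=
  q z.1 * (if z.2 = 1 then eps z.1 else 1 - eps z.1)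

/-- Binary entropy (base 2). -/
noncomputable def binEnt (p : ℝ) : ℝ :=
  -(p * Real.logb 2 p) - ((1 - p) * Real.logb 2 (1 - p))

/-- Capacity of the symmetric channel that is the mixture of the `BSC(eps e)`
with weights `q e`. -/
noncomputable def capacity {E : Type*} [Fintype E] (q eps : E → ℝ) : ℝ :=
  ∑ e, q e * (1 - binEnt (eps e))

open Classical in
/-- Joint probability of a (codeword, noise) pair: the codeword is uniform on the linear
code `C`, the noise is i.i.d. across coordinates. -/
noncomputable def jointP {ι E : Type*} [Fintype ι] [Fintype E]
    (C : Submodule (ZMod 2) (ι → ZMod 2)) (q eps : E → ℝ)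
    (ω : ↥C × (ι → E × ZMod 2)) : ℝ :=
  (Nat.card C : ℝ)⁻¹ * ∏ i, noiseP q eps (ω.2 i)

/-- Channel output on input codeword `x` and noise realization `z`. -/
def outputOf {ι E : Type*} (x : ι → ZMod 2) (z : ι → E × ZMod 2) : ι → E × ZMod 2 :=
  fun i => ((z i).1, x i + (z i).2)

open Classical in
/-- Posterior weight of the event `X_i = b` and the outputs on `S` agree with `y`. -/
noncomputable def post {ι E : Type*} [Fintype ι] [Fintype E]
    (C : Submodule (ZMod 2) (ι → ZMod 2)) (q eps : E → ℝ) (i : ι) (S : Finset ι)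
    (b : ZMod 2) (y : ι → E × ZMod 2) : ℝ :=
  ∑ ω : ↥C × (ι → E × ZMod 2),
    if (ω.1 : ι → ZMod 2) i = b ∧ ∀ j ∈ S, outputOf (ω.1 : ι → ZMod 2) ω.2 j = y j
    then jointP C q eps ω else 0

open Classical in
/-- ML (MAP) decoding of bit `i` from the outputs on `S`. -/
noncomputable def decodeBit {ι E : Type*} [Fintype ι] [Fintype E]
    (C : Submodule (ZMod 2) (ι → ZMod 2)) (q eps : E → ℝ) (i : ι) (S : Finset ι)
    (y : ι → E × ZMod 2) : ZMod 2 :=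
  if post C q eps i S 1 y > post C q eps i S 0 y then 1 else 0

open Classical in
/-- Probability that ML decoding of bit `i` from the outputs on `S` is wrong. -/
noncomputable def errP {ι E : Type*} [Fintype ι] [Fintype E]
    (C : Submodule (ZMod 2) (ι → ZMod 2)) (q eps : E → ℝ) (i : ι) (S : Finset ι) : ℝ :=
  ∑ ω : ↥C × (ι → E × ZMod 2),
    if decodeBit C q eps i S (outputOf (ω.1 : ι → ZMod 2) ω.2) ≠ (ω.1 : ι → ZMod 2) i
    then jointP C q eps ω else 0

/-- `P_loc,i` : error probability of ML decoding of `X_i` from all other outputs. -/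
noncomputable def Ploc {ι E : Type*} [Fintype ι] [DecidableEq ι] [Fintype E]
    (C : Submodule (ZMod 2) (ι → ZMod 2)) (q eps : E → ℝ) (i : ι) : ℝ :=
  errP C q eps i (Finset.univ.erase i)

/-- `P_bit,i` : error probability of ML decoding of `X_i` from the full output. -/
noncomputable def Pbit {ι E : Type*} [Fintype ι] [Fintype E]
    (C : Submodule (ZMod 2) (ι → ZMod 2)) (q eps : E → ℝ) (i : ι) : ℝ :=
  errP C q eps i Finset.univ

/-- Rate of a linear code. -/
noncomputable def rate {ι : Type*} [Fintype ι] (C : Submodule (ZMod 2) (ι → ZMod 2)) : ℝ :=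
  (Module.finrank (ZMod 2) ↥C : ℝ) / (Fintype.card ι)

/-- Validity of the symmetric-channel parameters: `q` is a probability vector and each
crossover probability lies in `[0, 1/2]`. -/
def ChannelValid {E : Type*} [Fintype E] (q eps : E → ℝ) : Prop :=
  (∀ e, 0 ≤ q e) ∧ (∑ e, q e = 1) ∧ (∀ e, 0 ≤ eps e ∧ eps e ≤ 1 / 2)

/-- The Reed–Muller code `RM(m,r)` as a linear code (submodule of the functions on `F_2^m`):
the span of the evaluation vectors of polynomials of total degree at most `r`. -/
def RMsub (m r : ℕ) : Submodule (ZMod 2) ((Fin m → ZMod 2) → ZMod 2) :=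
  Submodule.span (ZMod 2)
    {f | ∃ p : MvPolynomial (Fin m) (ZMod 2),
          p.totalDegree ≤ r ∧ ∀ x, f x = MvPolynomial.eval x p}

section CoordinateAverage

variable {ι Ω : Type*} [DecidableEq ι] [Fintype Ω]

/-- Average of `h` over the coordinate `s`. -/
noncomputable def avgAt (w : Ω → ℝ) (s : ι) (h : (ι → Ω) → ℝ) (z : ι → Ω) : ℝ :=
  ∑ a, w a * h (Function.update z s a)

theorem avgAt_mul_of_dependsOn (w : Ω → ℝ) {s : ι} {S : Set ι} (hs : s ∉ S)
    {f : (ι → Ω) → ℝ} (hf : DependsOn f S) (h : (ι → Ω) → ℝ) :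
    avgAt w s (fun z => f z * h z) = fun z => f z * avgAt w s h z := by
  funext z
  simp only [avgAt, Finset.mul_sum]
  refine Finset.sum_congr rfl fun a _ => ?_
  rw [hf (y := z) fun j hj => Function.update_of_ne (ne_of_mem_of_not_mem hj hs) _ _]
  ring

theorem avgAt_of_dependsOn {w : Ω → ℝ} (hw : ∑ a, w a = 1) {s : ι} {S : Set ι} (hs : s ∉ S)
    {f : (ι → Ω) → ℝ} (hf : DependsOn f S) : avgAt w s f = f := by
  have := avgAt_mul_of_dependsOn w hs hf fun _ => 1
  simpa [avgAt, hw] using this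

theorem dependsOn_avgAt (w : Ω → ℝ) {s : ι} {S : Set ι} {f : (ι → Ω) → ℝ}
    (hf : DependsOn f S) : DependsOn (avgAt w s f) (S \ {s}) := by
  intro x y hxy
  refine Finset.sum_congr rfl fun a _ => ?_
  rw [hf (y := Function.update y s a)]
  intro j hj
  by_cases h : j = s
  · subst h; simp
  · simp [h, hxy j ⟨hj, h⟩]

end CoordinateAverage

section ProductExpectation

variable {ι Ω : Type*} [Fintype ι] [DecidableEq ι] [Fintype Ω]

/-- Expectation of `h` when the coordinates are independent, each with weights `w`. -/
noncomputable def prodEx (w : Ω → ℝ) (h : (ι → Ω) → ℝ) : ℝ :=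
  ∑ z, (∏ j, w (z j)) * h z

theorem prodEx_const {w : Ω → ℝ} (hw : ∑ a, w a = 1) (c : ℝ) :
    prodEx (ι := ι) w (fun _ => c) = c := by
  unfold prodEx
  rw [← Finset.sum_mul, ← Fintype.prod_sum]
  simp [hw]

theorem prodEx_add (w : Ω → ℝ) (f g : (ι → Ω) → ℝ) :
    prodEx w (fun z => f z + g z) = prodEx w f + prodEx w g := by
  simp [prodEx, mul_add, Finset.sum_add_distrib]

theorem prodEx_const_mul (w : Ω → ℝ) (c : ℝ) (f : (ι → Ω) → ℝ) :
    prodEx w (fun z => c * f z) = c * prodEx w f := by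
  simp only [prodEx, Finset.mul_sum]
  exact Finset.sum_congr rfl fun z _ => by ring

theorem prodEx_sub (w : Ω → ℝ) (f g : (ι → Ω) → ℝ) :
    prodEx w (fun z => f z - g z) = prodEx w f - prodEx w g := by
  simp [prodEx, mul_sub, Finset.sum_sub_distrib]

theorem prodEx_sum {G : Type*} (t : Finset G) (w : Ω → ℝ) (f : G → (ι → Ω) → ℝ) :
    prodEx w (fun z => ∑ g ∈ t, f g z) = ∑ g ∈ t, prodEx w (f g) := by
  simp only [prodEx, Finset.mul_sum]
  exact Finset.sum_comm

theorem prodEx_mono_of_ne_zero {w : Ω → ℝ} (hw : ∀ a, 0 ≤ w a) {f g : (ι → Ω) → ℝ}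
    (h : ∀ z, (∀ j, w (z j) ≠ 0) → f z ≤ g z) : prodEx w f ≤ prodEx w g := by
  refine Finset.sum_le_sum fun z _ => ?_
  by_cases hz : ∀ j, w (z j) ≠ 0
  · exact mul_le_mul_of_nonneg_left (h z hz) (Finset.prod_nonneg fun j _ => hw _)
  · push Not at hz
    obtain ⟨j, hj⟩ := hz
    simp [Finset.prod_eq_zero (f := fun j => w (z j)) (Finset.mem_univ j) hj]

theorem prodEx_mono {w : Ω → ℝ} (hw : ∀ a, 0 ≤ w a) {f g : (ι → Ω) → ℝ}
    (h : ∀ z, f z ≤ g z) : prodEx w f ≤ prodEx w g :=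
  prodEx_mono_of_ne_zero hw fun z _ => h z

theorem prodEx_avgAt {w : Ω → ℝ} (hw : ∑ a, w a = 1) (s : ι) (h : (ι → Ω) → ℝ) :
    prodEx w (avgAt w s h) = prodEx w h := by
  have swap : ∑ p : (ι → Ω) × Ω, (∏ j, w (p.1 j)) * w p.2 * h (Function.update p.1 s p.2)
      = ∑ p : (ι → Ω) × Ω, (∏ j, w (p.1 j)) * w p.2 * h p.1 := by
    refine Finset.sum_bij' (fun p _ => (Function.update p.1 s p.2, p.1 s))
      (fun p _ => (Function.update p.1 s p.2, p.1 s)) (by simp) (by simp) (by simp) (by simp) ?_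
    rintro ⟨z, a⟩ -
    congr 1
    rw [← Finset.mul_prod_erase _ _ (Finset.mem_univ s),
      ← Finset.mul_prod_erase (a := s) _ (fun j => w (Function.update z s a j))
        (Finset.mem_univ s)]
    have : ∏ j ∈ Finset.univ.erase s, w (Function.update z s a j)
        = ∏ j ∈ Finset.univ.erase s, w (z j) :=
      Finset.prod_congr rfl fun j hj => by
        rw [Function.update_of_ne (Finset.ne_of_mem_erase hj)]
    simp only [this, Function.update_self]
    ring
  rw [Fintype.sum_prod_type, Fintype.sum_prod_type] at swap
  simp only [prodEx, avgAt, Finset.mul_sum]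
  calc _ = _ := Finset.sum_congr rfl fun z _ => Finset.sum_congr rfl fun a _ => by ring
    _ = _ := swap
    _ = _ := Finset.sum_congr rfl fun z _ => by
      dsimp only
      rw [← Finset.sum_mul, ← Finset.mul_sum, hw, mul_one]

theorem prodEx_mul_coord {w : Ω → ℝ} (hw : ∑ a, w a = 1) {s : ι} {S : Set ι} (hs : s ∉ S)
    {f : (ι → Ω) → ℝ} (hf : DependsOn f S) (h : Ω → ℝ) :
    prodEx w (fun z => f z * h (z s)) = prodEx w f * ∑ a, w a * h a := by
  rw [← prodEx_avgAt hw s, avgAt_mul_of_dependsOn w hs hf, mul_comm, ← prodEx_const_mul]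
  congr 1
  funext z
  simp [avgAt, mul_comm]

theorem prodEx_coord {w : Ω → ℝ} (hw : ∑ a, w a = 1) (s : ι) (h : Ω → ℝ) :
    prodEx w (fun z : ι → Ω => h (z s)) = ∑ a, w a * h a := by
  have := prodEx_mul_coord hw (Set.notMem_empty s) (f := fun _ => (1 : ℝ)) (fun _ _ _ => rfl) h
  simpa [prodEx_const hw] using this

/-- Pythagoras for the averaging of one coordinate. -/
theorem prodEx_sq_avgAt {w : Ω → ℝ} (hw : ∑ a, w a = 1) (s : ι) (f : (ι → Ω) → ℝ) :
    prodEx w (fun z => f z ^ 2)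
      = prodEx w (fun z => avgAt w s f z ^ 2) + prodEx w (fun z => (f z - avgAt w s f z) ^ 2) := by
  have cross : prodEx w (fun z => avgAt w s f z * f z) = prodEx w (fun z => avgAt w s f z ^ 2) := by
    have hd : DependsOn (avgAt w s f) (Set.univ \ {s}) :=
      dependsOn_avgAt w fun x y h => by rw [funext fun i => h i (Set.mem_univ i)]
    rw [← prodEx_avgAt hw s, avgAt_mul_of_dependsOn w (by simp) hd]
    simp only [sq]
  have : prodEx w (fun z => (f z - avgAt w s f z) ^ 2)
      = prodEx w (fun z => f z ^ 2) - 2 * prodEx w (fun z => avgAt w s f z * f z)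
        + prodEx w (fun z => avgAt w s f z ^ 2) := by
    rw [← prodEx_const_mul, ← prodEx_sub, ← prodEx_add]
    congr 1
    funext z
    ring
  rw [this, cross]
  ring

/-- If each coordinate is relevant to at most a fraction `ρ` of the functions `f g`, then
averaging over `g` reduces the variance by a factor `ρ`. -/
theorem variance_average_le {G : Type*} [Fintype G] {w : Ω → ℝ} (hw0 : ∀ a, 0 ≤ w a)
    (hw : ∑ a, w a = 1) {ρ : ℝ} (A : G → Set ι)
    (hρ : ∀ s, (Nat.card {g // s ∈ A g} : ℝ) ≤ ρ * Fintype.card G) (S : Finset ι)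
    (f : G → (ι → Ω) → ℝ) (hA : ∀ g, DependsOn (f g) (A g)) (hS : ∀ g, DependsOn (f g) S) :
    prodEx w (fun z => (∑ g, f g z) ^ 2) - (∑ g, prodEx w (f g)) ^ 2
      ≤ ρ * Fintype.card G * ∑ g, (prodEx w (fun z => f g z ^ 2) - prodEx w (f g) ^ 2) := by
  classical
  induction S using Finset.induction_on generalizing f with
  | empty =>
    by_cases hne : Nonempty (ι → Ω)
    · obtain ⟨z₀⟩ := hne
      have hc : ∀ g, f g = fun _ => f g z₀ := fun g => funext fun z => hS g (by simp)
      have e1 : ∀ g, prodEx w (f g) = f g z₀ := fun g => by rw [hc g, prodEx_const hw]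
      have e2 : ∀ g, prodEx w (fun z => f g z ^ 2) = f g z₀ ^ 2 := fun g => by
        rw [hc g, prodEx_const hw]
      have e3 : prodEx w (fun z => (∑ g, f g z) ^ 2) = (∑ g, f g z₀) ^ 2 := by
        rw [← prodEx_const (ι := ι) hw ((∑ g, f g z₀) ^ 2)]
        congr 1
        funext z
        congr 1
        exact Finset.sum_congr rfl fun g _ => hS g (by simp)
      simp [e1, e2, e3]
    · have := not_nonempty_iff.mp hne
      simp [prodEx]
  | insert s S hs ih =>
    have hsum : ∀ z, avgAt w s (fun z => ∑ g, f g z) z = ∑ g, avgAt w s (f g) z := fun z => by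
      simp only [avgAt, Finset.mul_sum]
      exact Finset.sum_comm
    have ih' := ih (fun g => avgAt w s (f g))
      (fun g x y h => dependsOn_avgAt w (hA g) fun i hi => h i hi.1)
      (fun g x y h => dependsOn_avgAt w (hS g) fun i hi => h i (by
        have := hi.1; have := hi.2; simp_all))
    simp only [prodEx_avgAt hw] at ih'
    have step : prodEx w (fun z => (∑ g, f g z - ∑ g, avgAt w s (f g) z) ^ 2)
        ≤ ρ * Fintype.card G * ∑ g, prodEx w (fun z => (f g z - avgAt w s (f g) z) ^ 2) := by
      rw [← prodEx_sum, ← prodEx_const_mul]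
      refine prodEx_mono hw0 fun z => ?_
      have h0 : ∑ g, f g z - ∑ g, avgAt w s (f g) z
          = ∑ g with s ∈ A g, (f g z - avgAt w s (f g) z) := by
        rw [← Finset.sum_sub_distrib, Finset.sum_filter]
        refine Finset.sum_congr rfl fun g _ => ?_
        split_ifs with h
        · rfl
        · rw [avgAt_of_dependsOn hw h (hA g), sub_self]
      rw [h0]
      refine sq_sum_le_card_mul_sum_sq.trans ?_
      have hc : ((Finset.univ.filter fun g => s ∈ A g).card : ℝ) ≤ ρ * Fintype.card G := by
        refine le_trans (le_of_eq ?_) (hρ s)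
        rw [Nat.card_eq_fintype_card, Fintype.card_subtype]
      refine mul_le_mul hc ?_ (Finset.sum_nonneg fun _ _ => sq_nonneg _)
        ((Nat.cast_nonneg _).trans hc)
      exact Finset.sum_le_sum_of_subset_of_nonneg (Finset.subset_univ _) fun _ _ _ => sq_nonneg _
    rw [prodEx_sq_avgAt hw s]
    simp only [hsum]
    have e : ∀ g, prodEx w (fun z => f g z ^ 2) - prodEx w (f g) ^ 2
        = (prodEx w (fun z => avgAt w s (f g) z ^ 2) - prodEx w (f g) ^ 2)
          + prodEx w (fun z => (f g z - avgAt w s (f g) z) ^ 2) := fun g => by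
      rw [prodEx_sq_avgAt hw s]
      ring
    simp only [e, Finset.sum_add_distrib, mul_add]
    linarith

theorem prodEx_comp_injective {κ : Type*} [Fintype κ] [DecidableEq κ] {w : Ω → ℝ}
    (hw : ∑ a, w a = 1) {ψ : κ → ι} (hψ : Function.Injective ψ) (h : (κ → Ω) → ℝ) :
    prodEx w (fun z : ι → Ω => h (z ∘ ψ)) = prodEx w h := by
  classical
  let e : κ ≃ {i // i ∈ Set.range ψ} := Equiv.ofInjective ψ hψ
  let E : (ι → Ω) ≃ ({i // i ∈ Set.range ψ} → Ω) × ({i // i ∉ Set.range ψ} → Ω) :=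
    Equiv.piEquivPiSubtypeProd (· ∈ Set.range ψ) (fun _ => Ω)
  have h1 : prodEx w (fun z : ι → Ω => h (z ∘ ψ))
      = ∑ p : ({i // i ∈ Set.range ψ} → Ω) × ({i // i ∉ Set.range ψ} → Ω),
        ((∏ j, w (p.1 j)) * h (p.1 ∘ e)) * ∏ j, w (p.2 j) := by
    refine Fintype.sum_equiv E _ _ fun z => ?_
    rw [← Fintype.prod_subtype_mul_prod_subtype (· ∈ Set.range ψ) (fun j => w (z j))]
    have : z ∘ ψ = (E z).1 ∘ e := rfl
    dsimp only
    rw [this]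
    simp only [E, Equiv.piEquivPiSubtypeProd_apply]
    rw [mul_right_comm]
    congr!
  rw [h1, Fintype.sum_prod_type]
  simp only [← Finset.mul_sum]
  rw [← Fintype.prod_sum]
  simp only [hw, Finset.prod_const_one, mul_one]
  refine Fintype.sum_equiv (e.arrowCongr (Equiv.refl Ω)).symm _ _ fun z => ?_
  have : (e.arrowCongr (Equiv.refl Ω)).symm z = z ∘ e := by ext; simp [Equiv.arrowCongr]
  rw [this]
  congr 1
  exact (Fintype.prod_equiv e _ _ fun _ => rfl).symm

/-- Chebyshev's inequality for the event that `F` is not positive. -/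
theorem prodEx_nonpos_le {w : Ω → ℝ} (hw0 : ∀ a, 0 ≤ w a) (hw : ∑ a, w a = 1)
    (F : (ι → Ω) → ℝ) (hF : 0 < prodEx w F) [DecidablePred fun z => F z ≤ 0] :
    prodEx w (fun z => if F z ≤ 0 then 1 else 0)
      ≤ (prodEx w (fun z => F z ^ 2) - prodEx w F ^ 2) / prodEx w F ^ 2 := by
  rw [le_div_iff₀ (by positivity), mul_comm, ← prodEx_const_mul]
  have : prodEx w (fun z => F z ^ 2) - prodEx w F ^ 2
      = prodEx w (fun z => (F z - prodEx w F) ^ 2) := by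
    have e : (fun z => (F z - prodEx w F) ^ 2)
        = fun z => (F z ^ 2 - 2 * prodEx w F * F z) + prodEx w F ^ 2 := by
      funext z; ring
    rw [e, prodEx_add, prodEx_sub, prodEx_const_mul, prodEx_const hw]
    ring
  rw [this]
  refine prodEx_mono hw0 fun z => ?_
  split_ifs with h
  · nlinarith
  · simpa using sq_nonneg _

end ProductExpectation


theorem ZMod.sum_two (f : ZMod 2 → ℝ) : ∑ b, f b = f 0 + f 1 :=
  Fin.sum_univ_two f

theorem ZMod.two_cases (b : ZMod 2) : b = 0 ∨ b = 1 := by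
  revert b; decide

/-- The sign `(-1)^b` of a bit. -/
noncomputable def bitSign (b : ZMod 2) : ℝ := if b = 0 then 1 else -1

theorem bitSign_zero : bitSign 0 = 1 := if_pos rfl

theorem bitSign_one : bitSign 1 = -1 := if_neg (by decide)

theorem bitSign_add (a b : ZMod 2) : bitSign (a + b) = bitSign a * bitSign b := by
  have h : (1 + 1 : ZMod 2) = 0 := by decide
  rcases ZMod.two_cases a with rfl | rfl <;> rcases ZMod.two_cases b with rfl | rfl <;>
    simp [bitSign_zero, bitSign_one, h]

theorem bitSign_mul_self (a : ZMod 2) : bitSign a * bitSign a = 1 := by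
  rcases ZMod.two_cases a with rfl | rfl <;> simp [bitSign_zero, bitSign_one]

theorem abs_bitSign (a : ZMod 2) : |bitSign a| = 1 := by
  rcases ZMod.two_cases a with rfl | rfl <;> simp [bitSign_zero, bitSign_one]

section Channel

variable {E : Type*}

/-- The correlation of a transmitted bit with its channel output: the likelihood of the output
`z` given the bit `b` is proportional to `1 + (-1)^b * outBias eps z`. -/
noncomputable def outBias (eps : E → ℝ) (z : E × ZMod 2) : ℝ :=
  bitSign z.2 * (1 - 2 * eps z.1)

theorem outBias_shift (eps : E → ℝ) (b : ZMod 2) (z : E × ZMod 2) :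
    outBias eps (z.1, b + z.2) = bitSign b * outBias eps z := by
  simp [outBias, bitSign_add, mul_assoc]

theorem noiseP_eq_outBias (q eps : E → ℝ) (z : E × ZMod 2) :
    noiseP q eps z = q z.1 / 2 * (1 + outBias eps z) := by
  obtain ⟨e, b⟩ := z
  rcases ZMod.two_cases b with rfl | rfl
  · simp [noiseP, outBias, bitSign_zero]; ring
  · simp [noiseP, outBias, bitSign_one]; ring

variable [Fintype E] {q eps : E → ℝ}

theorem abs_outBias_le (hch : ChannelValid q eps) (z : E × ZMod 2) : |outBias eps z| ≤ 1 := by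
  have := hch.2.2 z.1
  rw [outBias, abs_mul, abs_bitSign, one_mul, abs_le]
  constructor <;> linarith

theorem noiseP_nonneg (hch : ChannelValid q eps) (z : E × ZMod 2) : 0 ≤ noiseP q eps z := by
  rw [noiseP_eq_outBias]
  have := (abs_le.mp (abs_outBias_le hch z)).1
  have := hch.1 z.1
  exact mul_nonneg (by linarith) (by linarith)

theorem one_add_outBias_pos (hch : ChannelValid q eps) {z : E × ZMod 2}
    (hz : noiseP q eps z ≠ 0) : 0 < 1 + outBias eps z := by
  rw [noiseP_eq_outBias] at hz
  have := (abs_le.mp (abs_outBias_le hch z)).1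
  exact lt_of_le_of_ne (by linarith) (right_ne_zero_of_mul hz).symm

theorem sum_noiseP (hch : ChannelValid q eps) : ∑ z, noiseP q eps z = 1 := by
  rw [Fintype.sum_prod_type, ← hch.2.1]
  refine Finset.sum_congr rfl fun e _ => ?_
  rw [ZMod.sum_two]
  simp [noiseP]
  ring

theorem sum_noiseP_outBias (q eps : E → ℝ) :
    ∑ z, noiseP q eps z * outBias eps z = ∑ e, q e * (1 - 2 * eps e) ^ 2 := by
  rw [Fintype.sum_prod_type]
  refine Finset.sum_congr rfl fun e _ => ?_
  rw [ZMod.sum_two]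
  simp [noiseP, outBias, bitSign_zero, bitSign_one]
  ring

theorem sum_noiseP_outBias_nonneg (hch : ChannelValid q eps) :
    0 ≤ ∑ z, noiseP q eps z * outBias eps z := by
  rw [sum_noiseP_outBias]
  exact Finset.sum_nonneg fun e _ => mul_nonneg (hch.1 e) (sq_nonneg _)

theorem sum_noiseP_outBias_le_one (hch : ChannelValid q eps) :
    ∑ z, noiseP q eps z * outBias eps z ≤ 1 := by
  rw [← sum_noiseP hch]
  exact Finset.sum_le_sum fun z _ => mul_le_of_le_one_right (noiseP_nonneg hch z)
    ((le_abs_self _).trans (abs_outBias_le hch z))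

theorem sum_noiseP_log (hch : ChannelValid q eps) :
    ∑ z, noiseP q eps z * Real.log (1 + outBias eps z) = capacity q eps * Real.log 2 := by
  rw [Fintype.sum_prod_type, capacity, Finset.sum_mul]
  refine Finset.sum_congr rfl fun e _ => ?_
  rw [ZMod.sum_two]
  have h2 : Real.log 2 ≠ 0 := (Real.log_pos one_lt_two).ne'
  have he := hch.2.2 e
  have key : ∀ p : ℝ, p * Real.log (2 * p) = p * (Real.log 2 + Real.log p) := fun p => by
    by_cases hp : p = 0
    · simp [hp]
    · rw [Real.log_mul two_ne_zero hp]
  have k0 := key (1 - eps e)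
  have k1 := key (eps e)
  have e0 : 1 + (1 - 2 * eps e) = 2 * (1 - eps e) := by ring
  have e1 : 1 + -(1 - 2 * eps e) = 2 * eps e := by ring
  simp only [noiseP, outBias, bitSign_zero, bitSign_one, binEnt, Real.logb, one_mul, neg_one_mul,
    e0, e1, if_true, zero_ne_one, if_false, mul_assoc, k0, k1]
  field_simp
  ring

theorem prod_one_add_nonneg {ι : Type*} {S : Finset ι} (hch : ChannelValid q eps)
    (c : ι → ZMod 2) (z : ι → E × ZMod 2) :
    0 ≤ ∏ j ∈ S, (1 + bitSign (c j) * outBias eps (z j)) := by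
  refine Finset.prod_nonneg fun j _ => ?_
  have h : |bitSign (c j) * outBias eps (z j)| ≤ 1 := by
    rw [abs_mul, abs_bitSign, one_mul]
    exact abs_outBias_le hch _
  linarith [(abs_le.mp h).1]

end Channel

section BitEstimate

variable {ι E : Type*} [Fintype ι]

open Classical in
/-- Likelihood, up to normalization, of the outputs on `S`. -/
noncomputable def codeLik (C : Submodule (ZMod 2) (ι → ZMod 2)) (eps : E → ℝ) (S : Finset ι)
    (z : ι → E × ZMod 2) : ℝ :=
  ∑ c : C, ∏ j ∈ S, (1 + bitSign (c.1 j) * outBias eps (z j))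

open Classical in
/-- Likelihood of the outputs on `S`, signed by the transmitted bit at `i`. -/
noncomputable def signedLik (C : Submodule (ZMod 2) (ι → ZMod 2)) (eps : E → ℝ) (i : ι)
    (S : Finset ι) (z : ι → E × ZMod 2) : ℝ :=
  ∑ c : C, bitSign (c.1 i) * ∏ j ∈ S, (1 + bitSign (c.1 j) * outBias eps (z j))

/-- Posterior mean of the sign of the bit at `i` given the outputs on `S`. -/
noncomputable def bitEst (C : Submodule (ZMod 2) (ι → ZMod 2)) (eps : E → ℝ) (i : ι)
    (S : Finset ι) (z : ι → E × ZMod 2) : ℝ :=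
  signedLik C eps i S z / codeLik C eps S z

variable {C : Submodule (ZMod 2) (ι → ZMod 2)} {q eps : E → ℝ} {i : ι} {S : Finset ι}

theorem dependsOn_bitEst : DependsOn (bitEst C eps i S) S := by
  intro x y h
  have : ∀ c : ι → ZMod 2, ∏ j ∈ S, (1 + bitSign (c j) * outBias eps (x j))
      = ∏ j ∈ S, (1 + bitSign (c j) * outBias eps (y j)) := fun c =>
    Finset.prod_congr rfl fun j hj => by rw [h j hj]
  simp only [bitEst, signedLik, codeLik, this]

theorem bitEst_outputOf (x : C) (z : ι → E × ZMod 2) :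
    bitEst C eps i S (outputOf x.1 z) = bitSign (x.1 i) * bitEst C eps i S z := by
  classical
  have hp : ∀ c : C, ∏ j ∈ S, (1 + bitSign (c.1 j) * outBias eps (outputOf x.1 z j))
      = ∏ j ∈ S, (1 + bitSign ((c + x).1 j) * outBias eps (z j)) := fun c =>
    Finset.prod_congr rfl fun j _ => by
      rw [outputOf, outBias_shift, Submodule.coe_add, Pi.add_apply, bitSign_add, mul_assoc]
  have hL : codeLik C eps S (outputOf x.1 z) = codeLik C eps S z := by
    simp only [codeLik, hp]
    exact Fintype.sum_equiv (Equiv.addRight x) _ _ fun c => rfl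
  have hM : signedLik C eps i S (outputOf x.1 z) = bitSign (x.1 i) * signedLik C eps i S z := by
    simp only [signedLik, hp, Finset.mul_sum]
    refine Fintype.sum_equiv (Equiv.addRight x) _ _ fun c => ?_
    simp only [Equiv.coe_addRight, Submodule.coe_add, Pi.add_apply, bitSign_add]
    linear_combination (-bitSign (c.1 i) * ∏ j ∈ S,
      (1 + bitSign (c.1 j) * bitSign (x.1 j) * outBias eps (z j))) * bitSign_mul_self (x.1 i)
  rw [bitEst, bitEst, hL, hM, mul_div_assoc]

theorem codeLik_insert [DecidableEq ι] (hi : i ∉ S) (z : ι → E × ZMod 2) :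
    codeLik C eps (insert i S) z
      = codeLik C eps S z + signedLik C eps i S z * outBias eps (z i) := by
  classical
  simp only [codeLik, signedLik, Finset.sum_mul, ← Finset.sum_add_distrib]
  refine Finset.sum_congr rfl fun c _ => ?_
  rw [Finset.prod_insert hi]
  ring

variable [Fintype E]

theorem abs_bitEst_le_one (hch : ChannelValid q eps) (z : ι → E × ZMod 2) :
    |bitEst C eps i S z| ≤ 1 := by
  classical
  have h0 : 0 ≤ codeLik C eps S z := Finset.sum_nonneg fun c _ => prod_one_add_nonneg hch c.1 z
  rw [bitEst, abs_div, abs_of_nonneg h0]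
  refine div_le_one_of_le₀ ((Finset.abs_sum_le_sum_abs _ _).trans ?_) h0
  refine Finset.sum_le_sum fun c _ => ?_
  rw [abs_mul, abs_bitSign, one_mul, abs_of_nonneg (prod_one_add_nonneg hch c.1 z)]

theorem prod_le_codeLik (hch : ChannelValid q eps) (z : ι → E × ZMod 2) :
    ∏ j ∈ S, (1 + outBias eps (z j)) ≤ codeLik C eps S z := by
  classical
  have h := Finset.single_le_sum
    (f := fun c : C => ∏ j ∈ S, (1 + bitSign (c.1 j) * outBias eps (z j)))
    (fun c _ => prod_one_add_nonneg hch c.1 z) (Finset.mem_univ (0 : C))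
  simpa [bitSign_zero, codeLik] using h

theorem codeLik_pos (hch : ChannelValid q eps) {z : ι → E × ZMod 2}
    (hz : ∀ j, noiseP q eps (z j) ≠ 0) : 0 < codeLik C eps S z :=
  (Finset.prod_pos fun j _ => one_add_outBias_pos hch (hz j)).trans_le (prod_le_codeLik hch z)

theorem log_codeLik_insert_le [DecidableEq ι] (hch : ChannelValid q eps) (hi : i ∉ S)
    {z : ι → E × ZMod 2} (hz : ∀ j, noiseP q eps (z j) ≠ 0) :
    Real.log (codeLik C eps (insert i S) z)
      ≤ Real.log (codeLik C eps S z) + bitEst C eps i S z * outBias eps (z i) := by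
  have hL : 0 < codeLik C eps S z := codeLik_pos hch hz
  have hL' : 0 < codeLik C eps (insert i S) z := codeLik_pos hch hz
  have h : Real.log (codeLik C eps (insert i S) z / codeLik C eps S z)
      ≤ codeLik C eps (insert i S) z / codeLik C eps S z - 1 :=
    Real.log_le_sub_one_of_pos (div_pos hL' hL)
  rw [Real.log_div hL'.ne' hL.ne'] at h
  have e : codeLik C eps (insert i S) z / codeLik C eps S z - 1
      = bitEst C eps i S z * outBias eps (z i) := by
    rw [codeLik_insert hi, bitEst]
    field_simp
    ring
  linarith

/-- A code of rate below capacity admits a bit whose estimate from other outputs has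
non-vanishing bias. -/
theorem exists_bitEst_bias [DecidableEq ι] (hch : ChannelValid q eps) {β : ℝ} (hβ : 0 < β)
    (hC : Real.log (Nat.card C) + Fintype.card ι * β
      < Fintype.card ι * (capacity q eps * Real.log 2)) :
    ∃ i, ∃ S : Finset ι, i ∉ S ∧ β ≤ prodEx (noiseP q eps) (bitEst C eps i S) := by
  by_contra! hcon
  have hw := sum_noiseP hch
  have hw0 := noiseP_nonneg hch
  have small : ∀ i, ∀ S : Finset ι, i ∉ S →
      prodEx (noiseP q eps) (bitEst C eps i S) * ∑ z, noiseP q eps z * outBias eps z ≤ β := by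
    intro i S hi
    have h1 := sum_noiseP_outBias_nonneg hch
    have h2 := sum_noiseP_outBias_le_one hch
    nlinarith [hcon i S hi]
  have upper : ∀ S : Finset ι, prodEx (noiseP q eps) (fun z => Real.log (codeLik C eps S z))
      ≤ Real.log (Nat.card C) + S.card * β := by
    intro S
    induction S using Finset.induction_on with
    | empty =>
      classical
      have : ∀ z, codeLik C eps ∅ z = Nat.card C := fun z => by
        simp only [codeLik, Finset.prod_empty, Finset.sum_const, Finset.card_univ, nsmul_eq_mul,
          mul_one, Fintype.card_eq_nat_card]
      simp [this, prodEx_const hw]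
    | insert i S hi ih =>
      have h := prodEx_mono_of_ne_zero hw0
        (fun z hz => log_codeLik_insert_le (C := C) hch hi hz)
      rw [prodEx_add, prodEx_mul_coord hw (S := (S : Set ι)) (by simpa using hi)
        dependsOn_bitEst] at h
      rw [Finset.card_insert_of_notMem hi]
      push_cast
      linarith [small i S hi]
  have lower : Fintype.card ι * (capacity q eps * Real.log 2)
      ≤ prodEx (noiseP q eps) (fun z => Real.log (codeLik C eps Finset.univ z)) := by
    calc Fintype.card ι * (capacity q eps * Real.log 2)
        = prodEx (noiseP q eps) (fun z : ι → E × ZMod 2 =>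
            ∑ j, Real.log (1 + outBias eps (z j))) := by
          rw [prodEx_sum]
          simp only [prodEx_coord hw _ fun a => Real.log (1 + outBias eps a), sum_noiseP_log hch,
            Finset.sum_const, Finset.card_univ, nsmul_eq_mul]
      _ ≤ _ := by
          refine prodEx_mono_of_ne_zero hw0 fun z hz => ?_
          rw [← Real.log_prod fun j _ => (one_add_outBias_pos hch (hz j)).ne']
          exact Real.log_le_log (Finset.prod_pos fun j _ => one_add_outBias_pos hch (hz j))
            (prod_le_codeLik hch z)
  have := upper Finset.univ
  rw [Finset.card_univ] at this
  linarith

open Classical in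
/-- The error of bitwise ML decoding is at most that of any other decoder. -/
theorem errP_univ_le (C : Submodule (ZMod 2) (ι → ZMod 2)) (q eps : E → ℝ) (i : ι)
    (D : (ι → E × ZMod 2) → ZMod 2) :
    errP C q eps i Finset.univ
      ≤ ∑ ω : C × (ι → E × ZMod 2),
          if D (outputOf ω.1.1 ω.2) ≠ ω.1.1 i then jointP C q eps ω else 0 := by
  have group : ∀ D : (ι → E × ZMod 2) → ZMod 2,
      (∑ ω : C × (ι → E × ZMod 2),
          if D (outputOf ω.1.1 ω.2) ≠ ω.1.1 i then jointP C q eps ω else 0)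
        = ∑ y, post C q eps i Finset.univ (1 + D y) y := by
    intro D
    simp only [post]
    rw [Finset.sum_comm]
    refine Finset.sum_congr rfl fun ω _ => ?_
    rw [Finset.sum_eq_single (outputOf ω.1.1 ω.2)]
    · have : ∀ a b : ZMod 2, a ≠ b ↔ b = 1 + a := by decide
      simp [← this]
    · intro y _ hy
      rw [if_neg]
      rintro ⟨-, h⟩
      exact hy (funext fun j => (h j (Finset.mem_univ j)).symm)
    · simp
  rw [errP, group, group]
  refine Finset.sum_le_sum fun y _ => ?_
  have h2 : (1 + 1 : ZMod 2) = 0 := by decide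
  have hd : decodeBit C q eps i Finset.univ y = if post C q eps i Finset.univ 1 y
    > post C q eps i Finset.univ 0 y then 1 else 0 := rfl
  split_ifs at hd with h <;> rw [hd] <;> rcases ZMod.two_cases (D y) with h' | h' <;>
    simp only [h', h2, add_zero] <;> linarith

open Classical in
/-- An equivariant statistic that is positive with high probability decodes the bit. -/
theorem Pbit_le_of_equivariant (hch : ChannelValid q eps) {F : (ι → E × ZMod 2) → ℝ}
    (hF : ∀ (x : C) z, F (outputOf x.1 z) = bitSign (x.1 i) * F z) :
    Pbit C q eps i ≤ prodEx (noiseP q eps) (fun z => if F z ≤ 0 then 1 else 0) := by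
  refine (errP_univ_le C q eps i fun y => if F y < 0 then 1 else 0).trans ?_
  have hcard : (0 : ℝ) < Nat.card C := by exact_mod_cast Nat.card_pos
  rw [Fintype.sum_prod_type]
  have hx : ∀ x : C, (∑ z : ι → E × ZMod 2,
      if (if F (outputOf x.1 z) < 0 then (1 : ZMod 2) else 0) ≠ x.1 i
      then jointP C q eps (x, z) else 0)
      ≤ (Nat.card C : ℝ)⁻¹ * prodEx (noiseP q eps) (fun z => if F z ≤ 0 then 1 else 0) := by
    intro x
    rw [prodEx, Finset.mul_sum]
    refine Finset.sum_le_sum fun z _ => ?_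
    have hp : 0 ≤ jointP C q eps (x, z) :=
      mul_nonneg (inv_nonneg.mpr hcard.le) (Finset.prod_nonneg fun j _ => noiseP_nonneg hch _)
    by_cases hz : F z ≤ 0
    · rw [if_pos hz, mul_one]
      change _ ≤ jointP C q eps (x, z)
      split_ifs <;> linarith
    · rw [if_neg hz, if_neg]
      · simp
      · push Not at hz
        rw [not_not, hF]
        rcases ZMod.two_cases (x.1 i) with h | h <;> rw [h]
        · rw [bitSign_zero, if_neg]; linarith
        · rw [bitSign_one, if_pos]; linarith
  refine (Finset.sum_le_sum fun x _ => hx x).trans ?_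
  rw [Finset.sum_const, Finset.card_univ, nsmul_eq_mul, ← Nat.card_eq_fintype_card, ← mul_assoc,
    mul_inv_cancel₀ hcard.ne', one_mul]

end BitEstimate


section ReedMuller

/-- The evaluation vector of the squarefree monomial with variables in `S`. -/
def sqfreeMonomial {m : ℕ} (S : Finset (Fin m)) : (Fin m → ZMod 2) → ZMod 2 :=
  fun x => ∏ j ∈ S, x j

theorem eval_mem_span_sqfreeMonomial {m r : ℕ} {p : MvPolynomial (Fin m) (ZMod 2)}
    (hp : p.totalDegree ≤ r) :
    (fun x => MvPolynomial.eval x p) ∈ Submodule.span (ZMod 2)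
      (Set.range fun S : {S : Finset (Fin m) // S.card ≤ r} => sqfreeMonomial S.1) := by
  have hsum : (fun x => MvPolynomial.eval x p)
      = ∑ d ∈ p.support, p.coeff d • sqfreeMonomial d.support := by
    funext x
    rw [MvPolynomial.eval_eq, Finset.sum_apply]
    refine Finset.sum_congr rfl fun d _ => ?_
    simp only [Pi.smul_apply, smul_eq_mul, sqfreeMonomial]
    congr 1
    refine Finset.prod_congr rfl fun j hj => ?_
    have idem : ∀ a : ZMod 2, ∀ n ≠ 0, a ^ n = a := fun a n hn => by
      have : a = 0 ∨ a = 1 := by revert a; decide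
      rcases this with rfl | rfl
      · exact zero_pow hn
      · exact one_pow n
    exact idem _ _ (Finsupp.mem_support_iff.mp hj)
  rw [hsum]
  refine Submodule.sum_mem _ fun d hd => Submodule.smul_mem _ _ ?_
  refine Submodule.subset_span ⟨⟨d.support, le_trans ?_ hp⟩, rfl⟩
  refine le_trans ?_ (MvPolynomial.le_totalDegree hd)
  rw [Finset.card_eq_sum_ones]
  exact Finset.sum_le_sum fun j hj => Nat.one_le_iff_ne_zero.mpr (Finsupp.mem_support_iff.mp hj)

theorem eval_mem_RMsub {m r : ℕ} (p : MvPolynomial (Fin m) (ZMod 2)) (hp : p.totalDegree ≤ r) :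
    (fun x => MvPolynomial.eval x p) ∈ RMsub m r :=
  Submodule.subset_span ⟨p, hp, fun _ => rfl⟩

theorem prod_eval_mem_RMsub {m r : ℕ} {κ : Type*} (S : Finset κ) (hS : S.card ≤ r)
    (P : κ → MvPolynomial (Fin m) (ZMod 2)) (hP : ∀ j, (P j).totalDegree ≤ 1) :
    (fun x => ∏ j ∈ S, MvPolynomial.eval x (P j)) ∈ RMsub m r := by
  have := eval_mem_RMsub (∏ j ∈ S, P j) (r := r) <| by
    refine (MvPolynomial.totalDegree_finsetProd _ _).trans (le_trans ?_ hS)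
    rw [Finset.card_eq_sum_ones]
    exact Finset.sum_le_sum fun j _ => hP j
  simpa only [map_prod] using this

theorem RMsub_eq_span (m r : ℕ) :
    RMsub m r = Submodule.span (ZMod 2)
      (Set.range fun S : {S : Finset (Fin m) // S.card ≤ r} => sqfreeMonomial S.1) := by
  refine le_antisymm (Submodule.span_le.mpr ?_) (Submodule.span_le.mpr ?_)
  · rintro f ⟨p, hp, hf⟩
    rw [funext hf]
    exact eval_mem_span_sqfreeMonomial hp
  · rintro _ ⟨S, rfl⟩
    have := prod_eval_mem_RMsub S.1 S.2 (fun j => MvPolynomial.X j)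
      fun j => (MvPolynomial.totalDegree_X j).le
    simp only [MvPolynomial.eval_X] at this
    exact this

theorem linearIndependent_sqfreeMonomial (m : ℕ) :
    LinearIndependent (ZMod 2) (sqfreeMonomial (m := m)) := by
  refine linearIndependent_of_top_le_span_of_card_eq_finrank ?_ ?_
  · rintro f -
    have hf : f ∈ (MvPolynomial.restrictDegree (Fin m) (ZMod 2)
        (Fintype.card (ZMod 2) - 1)).map (MvPolynomial.evalₗ (ZMod 2) (Fin m)) := by
      rw [MvPolynomial.map_restrict_dom_evalₗ]
      trivial
    obtain ⟨p, -, rfl⟩ := hf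
    refine Submodule.span_mono ?_ (eval_mem_span_sqfreeMonomial (p := p) le_rfl)
    rintro _ ⟨S, rfl⟩
    exact ⟨S.1, rfl⟩
  · simp [Module.finrank_fintype_fun_eq_card]

theorem finrank_RMsub (m r : ℕ) :
    Module.finrank (ZMod 2) (RMsub m r) = ∑ i ∈ Finset.range (r + 1), m.choose i := by
  classical
  have hli : LinearIndependent (ZMod 2)
      fun S : {S : Finset (Fin m) // S.card ≤ r} => sqfreeMonomial S.1 :=
    (linearIndependent_sqfreeMonomial m).comp _ Subtype.val_injective
  rw [RMsub_eq_span, finrank_span_eq_card hli, Fintype.card_subtype,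
    Finset.card_eq_sum_card_fiberwise (f := Finset.card) (t := Finset.range (r + 1))]
  · refine Finset.sum_congr rfl fun i hi => ?_
    have : (Finset.univ.filter fun S : Finset (Fin m) => S.card ≤ r).filter (fun S => S.card = i)
        = Finset.powersetCard i Finset.univ := by
      ext S
      simp only [Finset.mem_range] at hi
      simp only [Finset.mem_filter, Finset.mem_univ, true_and, Finset.mem_powersetCard,
        Finset.subset_univ]
      omega
    rw [this, Finset.card_powersetCard, Finset.card_univ, Fintype.card_fin]
  · intro S hS
    simpa [Nat.lt_succ_iff] using hS

theorem comp_affine_mem_RMsub {m k r : ℕ} {f : (Fin m → ZMod 2) → ZMod 2} (hf : f ∈ RMsub m r)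
    (A : (Fin k → ZMod 2) →ₗ[ZMod 2] (Fin m → ZMod 2)) (b : Fin m → ZMod 2) :
    (fun x => f (A x + b)) ∈ RMsub k r := by
  have key : RMsub m r
      ≤ (RMsub k r).comap (LinearMap.funLeft (ZMod 2) (ZMod 2) fun x => A x + b) := by
    rw [RMsub_eq_span m r, Submodule.span_le]
    rintro _ ⟨S, rfl⟩
    have h := prod_eval_mem_RMsub S.1 S.2 (fun j => ∑ l, MvPolynomial.C (A (Pi.single l 1) j)
      * MvPolynomial.X l + MvPolynomial.C (b j)) fun j => by
        refine (MvPolynomial.totalDegree_add _ _).trans (max_le ?_ (by simp))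
        refine MvPolynomial.totalDegree_finsetSum_le fun l _ => ?_
        refine (MvPolynomial.totalDegree_mul _ _).trans ?_
        simp
    have hA : ∀ x j, A x j = ∑ l, A (Pi.single l 1) j * x l := fun x j => by
      conv_lhs => rw [LinearMap.pi_apply_eq_sum_univ A x, Finset.sum_apply]
      refine Finset.sum_congr rfl fun l _ => ?_
      rw [Pi.smul_apply, smul_eq_mul, mul_comm]
      refine congrArg (fun v => A v j * x l) (funext fun i => ?_)
      simp [Pi.single_apply, eq_comm]
    have e : (LinearMap.funLeft (ZMod 2) (ZMod 2) fun x => A x + b) (sqfreeMonomial S.1)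
        = fun x => ∏ j ∈ S.1, MvPolynomial.eval x (∑ l, MvPolynomial.C (A (Pi.single l 1) j)
          * MvPolynomial.X l + MvPolynomial.C (b j)) := by
      funext x
      simp only [LinearMap.funLeft_apply, sqfreeMonomial, Pi.add_apply, map_add, map_sum, map_mul,
        MvPolynomial.eval_C, MvPolynomial.eval_X]
      exact Finset.prod_congr rfl fun j _ => by rw [hA x j]
    change _ ∈ RMsub k r
    rw [e]
    exact h
  exact key hf

/-- A family of `k`-dimensional subspaces of `𝔽₂^m`, given by embeddings, in which each point
is a nonzero vector of a fraction at most `2^-(m - k)` of the subspaces. -/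
theorem exists_spread_embeddings {m k : ℕ} (hm : m ≠ 0) (hk : k ≤ m) :
    ∃ (G : Type) (_ : Fintype G) (_ : Nonempty G)
      (A : G → (Fin k → ZMod 2) →ₗ[ZMod 2] (Fin m → ZMod 2)),
      (∀ g, Function.Injective (A g)) ∧
      ∀ s, Nat.card {g // ∃ x, x ≠ 0 ∧ A g x = s} * 2 ^ (m - k) ≤ Fintype.card G := by
  classical
  let K := GaloisField 2 m
  have : Fintype K := Fintype.ofFinite K
  let e : K ≃ₗ[ZMod 2] (Fin m → ZMod 2) :=
    LinearEquiv.ofFinrankEq _ _ (by rw [GaloisField.finrank 2 hm, Module.finrank_fin_fun])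
  let j : (Fin k → ZMod 2) →ₗ[ZMod 2] K :=
    e.symm.toLinearMap ∘ₗ Function.ExtendByZero.linearMap (ZMod 2) (Fin.castLE hk)
  have hj : Function.Injective j := by
    refine e.symm.injective.comp fun x y h => ?_
    funext i
    have := congrFun h (Fin.castLE hk i)
    simp only [Function.ExtendByZero.linearMap_apply] at this
    rwa [(Fin.castLE_injective hk).extend_apply, (Fin.castLE_injective hk).extend_apply] at this
  refine ⟨Kˣ, inferInstance, inferInstance,
    fun g => e.toLinearMap ∘ₗ LinearMap.mulLeft (ZMod 2) (g : K) ∘ₗ j, fun g => ?_, ?_⟩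
  · exact e.injective.comp ((mul_right_injective₀ g.ne_zero).comp hj)
  · intro s
    have hcard : Nat.card {g : Kˣ // ∃ x, x ≠ 0 ∧
        (e.toLinearMap ∘ₗ LinearMap.mulLeft (ZMod 2) (g : K) ∘ₗ j) x = s} ≤ 2 ^ k - 1 := by
      have hx : Nat.card {x : Fin k → ZMod 2 // x ≠ 0} = 2 ^ k - 1 := by
        simp [Fintype.card_subtype_compl]
      rw [← hx]
      refine Nat.card_le_card_of_injective
        (fun g => ⟨g.2.choose, g.2.choose_spec.1⟩) fun g g' h => ?_
      have h1 := g.2.choose_spec.2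
      have h2 := g'.2.choose_spec.2
      have hx0 := g.2.choose_spec.1
      rw [← Subtype.mk.inj h] at h2
      have h3 := e.injective (h2.trans h1.symm)
      exact Subtype.ext (Units.ext (mul_right_cancel₀
        (fun h0 => hx0 (hj (h0.trans (map_zero j).symm))) h3).symm)
    have hK : Fintype.card Kˣ = 2 ^ m - 1 := by
      rw [← Nat.card_eq_fintype_card, Nat.card_units, GaloisField.card 2 m hm]
    rw [hK]
    refine (Nat.mul_le_mul_right _ hcard).trans ?_
    rw [Nat.sub_mul, ← pow_add, Nat.add_sub_cancel' hk]
    have : 1 ≤ 2 ^ (m - k) := Nat.one_le_two_pow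
    omega

end ReedMuller

section BinomialTail

theorem centralBinom_sq_mul_le (n : ℕ) : n.centralBinom ^ 2 * (2 * n + 1) ≤ 16 ^ n := by
  induction n with
  | zero => simp
  | succ n ih =>
    have h := Nat.succ_mul_centralBinom_succ n
    have hpos : 0 < (n + 1) ^ 2 := by positivity
    refine Nat.le_of_mul_le_mul_left ?_ hpos
    calc (n + 1) ^ 2 * ((n + 1).centralBinom ^ 2 * (2 * (n + 1) + 1))
        = ((n + 1) * (n + 1).centralBinom) ^ 2 * (2 * n + 3) := by ring
      _ = (n.centralBinom ^ 2 * (2 * n + 1)) * (4 * ((2 * n + 1) * (2 * n + 3))) := by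
          rw [h]; ring
      _ ≤ 16 ^ n * (16 * (n + 1) ^ 2) := Nat.mul_le_mul ih (by nlinarith)
      _ = (n + 1) ^ 2 * 16 ^ (n + 1) := by ring

theorem choose_sq_mul_le (m r : ℕ) : m.choose r ^ 2 * (m + 1) ≤ 4 ^ m := by
  obtain ⟨n, rfl | rfl⟩ := m.even_or_odd'
  · calc _ ≤ n.centralBinom ^ 2 * (2 * n + 1) :=
          Nat.mul_le_mul_right _ (Nat.pow_le_pow_left (Nat.choose_le_centralBinom r n) 2)
      _ ≤ 16 ^ n := centralBinom_sq_mul_le n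
      _ = 4 ^ (2 * n) := by rw [pow_mul]; norm_num
  · have h1 : 2 * (2 * n + 1).choose r ≤ (n + 1).centralBinom := by
      have hs : (n + 1).centralBinom = 2 * (2 * n + 1).choose n := by
        rw [Nat.centralBinom_eq_two_mul_choose, show 2 * (n + 1) = 2 * n + 1 + 1 by ring,
          Nat.choose_succ_succ, Nat.choose_symm_half]
        ring
      have := Nat.choose_le_middle r (2 * n + 1)
      rw [show (2 * n + 1) / 2 = n by omega] at this
      omega
    have h2 := centralBinom_sq_mul_le (n + 1)
    have h3 : 4 * ((2 * n + 1).choose r ^ 2 * (2 * n + 1 + 1)) ≤ 4 * 4 ^ (2 * n + 1) := by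
      calc _ ≤ (2 * (2 * n + 1).choose r) ^ 2 * (2 * (n + 1) + 1) := by
            rw [mul_pow]; nlinarith [sq_nonneg ((2 * n + 1).choose r)]
        _ ≤ (n + 1).centralBinom ^ 2 * (2 * (n + 1) + 1) :=
            Nat.mul_le_mul_right _ (Nat.pow_le_pow_left h1 2)
        _ ≤ 16 ^ (n + 1) := h2
        _ = 4 * 4 ^ (2 * n + 1) := by
            rw [show 16 = 4 ^ 2 by norm_num, ← pow_mul]; ring
    omega

theorem choose_div_two_pow_le (m r : ℕ) : (m.choose r : ℝ) / 2 ^ m ≤ 1 / Real.sqrt (m + 1) := by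
  have hs : 0 < Real.sqrt ((m : ℝ) + 1) := Real.sqrt_pos.mpr (by positivity)
  rw [div_le_div_iff₀ (by positivity) hs, one_mul]
  have h : ((m.choose r : ℝ)) ^ 2 * (m + 1) ≤ 4 ^ m := by exact_mod_cast choose_sq_mul_le m r
  refine le_of_sq_le_sq ?_ (by positivity)
  rw [mul_pow, Real.sq_sqrt (by positivity), ← pow_mul, mul_comm m 2, pow_mul]
  norm_num
  exact h

theorem rate_RMsub (m r : ℕ) :
    rate (RMsub m r) = (∑ i ∈ Finset.range (r + 1), (m.choose i : ℝ)) / 2 ^ m := by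
  rw [rate, finrank_RMsub]
  simp

theorem rate_RMsub_succ (m r : ℕ) :
    rate (RMsub m r) = rate (RMsub (m + 1) r) + (m.choose r : ℝ) / 2 ^ m / 2 := by
  have h : ∑ i ∈ Finset.range (r + 1), ((m + 1).choose i : ℝ) + m.choose r
      = 2 * ∑ i ∈ Finset.range (r + 1), (m.choose i : ℝ) := by
    induction r with
    | zero => simp; norm_num
    | succ r ih =>
      rw [Finset.sum_range_succ, Finset.sum_range_succ (fun i => (m.choose i : ℝ)),
        Nat.choose_succ_succ]
      push_cast
      linarith
  rw [rate_RMsub, rate_RMsub, pow_succ]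
  field_simp
  linarith

theorem rate_RMsub_le_add (m k r : ℕ) :
    rate (RMsub m r) ≤ rate (RMsub (m + k) r) + k / Real.sqrt (m + 1) := by
  induction k with
  | zero => simp
  | succ k ih =>
    have h1 := rate_RMsub_succ (m + k) r
    have h2 := choose_div_two_pow_le (m + k) r
    have h3 : 1 / Real.sqrt ((m + k : ℕ) + 1) ≤ 1 / Real.sqrt ((m : ℝ) + 1) := by
      refine one_div_le_one_div_of_le (Real.sqrt_pos.mpr (by positivity)) (Real.sqrt_le_sqrt ?_)
      push_cast
      linarith [(Nat.cast_nonneg k : (0 : ℝ) ≤ k)]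
    have h4 : (0 : ℝ) ≤ ((m + k).choose r : ℝ) / 2 ^ (m + k) := by positivity
    rw [← add_assoc]
    push_cast
    rw [add_div]
    linarith

end BinomialTail


theorem log_card_RMsub (m r : ℕ) :
    Real.log (Nat.card (RMsub m r))
      = Fintype.card (Fin m → ZMod 2) * (rate (RMsub m r) * Real.log 2) := by
  have h : (Fintype.card (Fin m → ZMod 2) : ℝ) ≠ 0 := by
    exact_mod_cast Fintype.card_ne_zero
  rw [Module.natCard_eq_pow_finrank (K := ZMod 2), Nat.card_zmod, rate]
  push_cast
  rw [Real.log_pow]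
  field_simp

theorem Pbit_RMsub_le {E : Type*} [Fintype E] {q eps : E → ℝ} (hch : ChannelValid q eps)
    {m k r : ℕ} (hm : m + k ≠ 0) {β : ℝ} (hβ : 0 < β)
    (hrate : rate (RMsub m r) * Real.log 2 + β < capacity q eps * Real.log 2)
    (i : Fin (m + k) → ZMod 2) :
    Pbit (RMsub (m + k) r) q eps i ≤ ((2 : ℝ) ^ k)⁻¹ / β ^ 2 := by
  classical
  have hw := sum_noiseP hch
  have hw0 := noiseP_nonneg hch
  obtain ⟨i₀, S, hi₀, hμ⟩ := exists_bitEst_bias (C := RMsub m r) hch hβ <| by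
    rw [log_card_RMsub, ← mul_add]
    exact mul_lt_mul_of_pos_left hrate (by exact_mod_cast Fintype.card_pos)
  set T := bitEst (RMsub m r) eps i₀ S
  set μ := prodEx (noiseP q eps) T
  obtain ⟨G, _, _, A, hinj, hspread⟩ := exists_spread_embeddings hm (Nat.le_add_right m k)
  let ψ : G → (Fin m → ZMod 2) → (Fin (m + k) → ZMod 2) := fun g x => A g x + (i - A g i₀)
  have hψ : ∀ g, Function.Injective (ψ g) := fun g => (add_left_injective _).comp (hinj g)
  have hψ₀ : ∀ g, ψ g i₀ = i := fun g => by simp [ψ]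
  let f : G → ((Fin (m + k) → ZMod 2) → E × ZMod 2) → ℝ := fun g z => T (z ∘ ψ g)
  have hf : ∀ g, prodEx (noiseP q eps) (f g) = μ := fun g => prodEx_comp_injective hw (hψ g) T
  have hdep : ∀ g, DependsOn (f g) (ψ g '' S) := fun g x y h =>
    dependsOn_bitEst fun j hj => h _ ⟨j, hj, rfl⟩
  have hG : (0 : ℝ) < Fintype.card G := by exact_mod_cast Fintype.card_pos
  have hρ : ∀ s, (Nat.card {g // s ∈ ψ g '' (S : Set (Fin m → ZMod 2))} : ℝ)
      ≤ ((2 : ℝ) ^ k)⁻¹ * Fintype.card G := by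
    intro s
    have h1 : Nat.card {g // s ∈ ψ g '' (S : Set (Fin m → ZMod 2))}
        ≤ Nat.card {g // ∃ x, x ≠ 0 ∧ A g x = s - i} := by
      refine Nat.card_le_card_of_injective (Subtype.map id ?_)
        (Subtype.map_injective _ Function.injective_id)
      rintro g ⟨x, hx, rfl⟩
      refine ⟨x - i₀, sub_ne_zero.mpr fun h => hi₀ (h ▸ hx), ?_⟩
      simp only [ψ, map_sub, id]
      abel
    have h2 := (Nat.mul_le_mul_right _ h1).trans (hspread (s - i))
    rw [Nat.add_sub_cancel_left] at h2
    rw [inv_mul_eq_div, le_div_iff₀ (by positivity)]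
    exact_mod_cast h2
  have hequi : ∀ (x : RMsub (m + k) r) z,
      ∑ g, f g (outputOf x.1 z) = bitSign (x.1 i) * ∑ g, f g z := by
    intro x z
    rw [Finset.mul_sum]
    refine Finset.sum_congr rfl fun g _ => ?_
    have h := bitEst_outputOf (eps := eps) (i := i₀) (S := S)
      (⟨_, comp_affine_mem_RMsub x.2 (A g) (i - A g i₀)⟩ : RMsub m r) (z ∘ ψ g)
    change _ = bitSign (x.1 (ψ g i₀)) * _ at h
    rw [hψ₀] at h
    exact h
  have hEF : prodEx (noiseP q eps) (fun z => ∑ g, f g z) = Fintype.card G * μ := by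
    rw [prodEx_sum]
    simp [hf]
  have hvar := variance_average_le hw0 hw _ hρ Finset.univ f hdep
    fun g x y h => congrArg (f g) (funext fun j => h j (by simp))
  have hle : ∑ g, (prodEx (noiseP q eps) (fun z => f g z ^ 2) - prodEx (noiseP q eps) (f g) ^ 2)
      ≤ Fintype.card G := by
    calc _ ≤ ∑ _g : G, (1 : ℝ) := by
          refine Finset.sum_le_sum fun g _ => ?_
          have : prodEx (noiseP q eps) (fun z => f g z ^ 2) ≤ 1 := by
            rw [← prodEx_const (ι := Fin (m + k) → ZMod 2) hw 1]
            refine prodEx_mono hw0 fun z => ?_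
            exact (sq_le_one_iff_abs_le_one _).mpr (abs_bitEst_le_one hch _)
          linarith [sq_nonneg (prodEx (noiseP q eps) (f g))]
      _ = Fintype.card G := by simp
  have hμ0 : 0 < μ := hβ.trans_le hμ
  have hcheb := prodEx_nonpos_le hw0 hw (fun z => ∑ g, f g z)
    (by rw [hEF]; exact mul_pos hG hμ0)
  have hPbit := Pbit_le_of_equivariant hch (F := fun z => ∑ g, f g z) hequi
  have hPbit' : Pbit (RMsub (m + k) r) q eps i
      ≤ prodEx (noiseP q eps) (fun z => if ∑ g, f g z ≤ 0 then 1 else 0) := by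
    convert hPbit
  refine hPbit'.trans (hcheb.trans ?_)
  rw [hEF]
  simp only [hf] at hvar
  simp only [hf] at hle
  rw [Finset.sum_const, Finset.card_univ, nsmul_eq_mul] at hvar
  calc _ ≤ ((2 : ℝ) ^ k)⁻¹ * Fintype.card G * Fintype.card G / (Fintype.card G * μ) ^ 2 := by
        gcongr
        exact hvar.trans (mul_le_mul_of_nonneg_left hle (by positivity))
    _ = ((2 : ℝ) ^ k)⁻¹ / μ ^ 2 := by field_simp
    _ ≤ ((2 : ℝ) ^ k)⁻¹ / β ^ 2 := by gcongr

theorem eventually_ceil_sqrt_div_logb {γ : ℝ} (hγ : 0 < γ) :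
    ∀ᶠ m : ℕ in Filter.atTop, 2 * ⌈Real.sqrt m / Real.logb 2 m⌉₊ ≤ m ∧
      ∀ l : ℕ, l + ⌈Real.sqrt m / Real.logb 2 m⌉₊ = m →
        ⌈Real.sqrt m / Real.logb 2 m⌉₊ / Real.sqrt (l + 1) < γ := by
  have hlog : Filter.Tendsto (fun m : ℕ => Real.logb 2 (m : ℝ)) Filter.atTop Filter.atTop :=
    (Real.tendsto_logb_atTop one_lt_two).comp tendsto_natCast_atTop_atTop
  have hsqrt : Filter.Tendsto (fun m : ℕ => Real.sqrt (m : ℝ)) Filter.atTop Filter.atTop :=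
    Real.tendsto_sqrt_atTop.comp tendsto_natCast_atTop_atTop
  have hlim : Filter.Tendsto (fun m : ℕ => 2 / Real.logb 2 (m : ℝ) + 2 / Real.sqrt m)
      Filter.atTop (nhds 0) := by
    simpa using (hlog.const_div_atTop 2).add (hsqrt.const_div_atTop 2)
  filter_upwards [hlim.eventually_lt_const hγ, hlog.eventually_ge_atTop 1,
    hsqrt.eventually_ge_atTop 4] with m hm hL hs
  have hm0 : (0 : ℝ) ≤ m := Nat.cast_nonneg m
  have hsq := Real.sq_sqrt hm0
  set s := Real.sqrt (m : ℝ)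
  have hk : (⌈s / Real.logb 2 m⌉₊ : ℝ) ≤ s / Real.logb 2 m + 1 :=
    (Nat.ceil_lt_add_one (by positivity)).le
  set k := ⌈s / Real.logb 2 m⌉₊
  have hks : s / Real.logb 2 m ≤ s := div_le_self (by positivity) hL
  have h2k : 2 * (k : ℝ) ≤ m := by nlinarith
  refine ⟨by exact_mod_cast h2k, fun l hl => ?_⟩
  have hl' : (l : ℝ) + k = m := by exact_mod_cast hl
  have hroot : s / 2 ≤ Real.sqrt (l + 1) := Real.le_sqrt_of_sq_le (by nlinarith)
  calc (k : ℝ) / Real.sqrt (l + 1) ≤ (s / Real.logb 2 m + 1) / (s / 2) := by gcongr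
    _ = 2 / Real.logb 2 m + 2 / s := by field_simp
    _ < γ := hm

open Classical in
/-- A Reed–Muller code of asymptotic rate `R` below the capacity of a binary-input
memoryless symmetric channel has bitwise-ML bit-error probability
`P_bit = O(2^{-√(log n)/log log n}) → 0`, where `n = 2^m`. -/
theorem stmt17 {E : Type*} [Fintype E] (q eps : E → ℝ) (hch : ChannelValid q eps)
    (R : ℝ) (hR : R < capacity q eps) :
    ∃ K > (0 : ℝ), ∃ M : ℕ, ∀ m ≥ M, ∀ r : ℕ,
      rate (RMsub m r) ≤ R →
      ∀ i : Fin m → ZMod 2,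
        Pbit (RMsub m r) q eps i
          ≤ K * (2 : ℝ) ^ (-(Real.sqrt (Real.logb 2 ((2 : ℝ) ^ m))
              / Real.logb 2 (Real.logb 2 ((2 : ℝ) ^ m)))) := by
  have hγ : 0 < (capacity q eps - R) / 2 := by linarith
  have hlog2 : 0 < Real.log 2 := Real.log_pos one_lt_two
  have hβ : 0 < (capacity q eps - R) / 2 * Real.log 2 := mul_pos hγ hlog2
  obtain ⟨M, hM⟩ := Filter.eventually_atTop.mp (eventually_ceil_sqrt_div_logb hγ)
  refine ⟨(((capacity q eps - R) / 2 * Real.log 2) ^ 2)⁻¹, by positivity, max M 1,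
    fun m hm r hrate i => ?_⟩
  obtain ⟨h2k, hk⟩ := hM m (le_of_max_le_left hm)
  have hm1 : 1 ≤ m := le_of_max_le_right hm
  have hlogb : Real.logb 2 ((2 : ℝ) ^ m) = m := by
    rw [Real.logb_pow, Real.logb_self_eq_one one_lt_two, mul_one]
  rw [hlogb]
  have hceil := Nat.le_ceil (Real.sqrt m / Real.logb 2 m)
  generalize ⌈Real.sqrt m / Real.logb 2 m⌉₊ = k at h2k hk hceil
  obtain ⟨l, rfl⟩ : ∃ l, m = l + k := ⟨m - k, by omega⟩
  have hl : rate (RMsub l r) < R + (capacity q eps - R) / 2 :=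
    (rate_RMsub_le_add l k r).trans_lt (add_lt_add_of_le_of_lt hrate (hk l rfl))
  refine (Pbit_RMsub_le hch (by omega) hβ (by nlinarith) i).trans ?_
  rw [div_eq_inv_mul, ← Real.rpow_natCast 2 k, ← Real.rpow_neg zero_le_two]
  gcongr
  exact one_le_two
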